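/- Let (X, ρ, 𝒞) be a semi-Cartan graph with GRS Δ and nil-Hecke algebra 𝒩 over 𝕂 = ℤ[t_1,…,t_θ]. Let x ∈ X satisfy ρ_1(x) = ρ_2(x) = x and suppose d := m^x_{12} is finite. For n ∈ ℕ_0 set i_{2n} = 2, i_{2n+1} = 1, j_{2n} = 1, j_{2n+1} = 2. Then in 𝒩: h_{i_1}^x(t_{i_1}) h_{i_2}^x(s_{i_1}^x·t_{i_2}) ⋯ h_{i_d}^x(s_{i_1}^x ⋯ s_{i_{d−1}}·t_{i_d}) = h_{j_1}^x(t_{j_1}) h_{j_2}^x(s_{j_1}^x·t_{j_2}) ⋯ h_{j_d}^x(s_{j_1}^x ⋯ s_{j_{d−1}}·t_{j_d}). -/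

import Mathlib

open CategoryTheory

noncomputable section

namespace WeylGroupoid

variable {θ : ℕ} {X : Type} [Fintype X] [DecidableEq X]

/-- A *semi-Cartan graph*: a basic datum `(X, ρ)` together with a compatible bundle of
generalized Cartan matrices. -/
structure SCG (θ : ℕ) (X : Type) [Fintype X] [DecidableEq X] : Type where
  nonempty : Nonempty X
  /-- the involutions `ρ_i` of the basic datum -/
  ρ : Fin θ → X → X
  invol : ∀ i x, ρ i (ρ i x) = x
  /-- the bundle of generalized Cartan matrices `C^x` -/
  C : X → Fin θ → Fin θ → ℤ
  diag : ∀ x i, C x i i = 2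
  offdiag : ∀ x i j, i ≠ j → C x i j ≤ 0
  zero_iff : ∀ x i j, i ≠ j → (C x i j = 0 ↔ C x j i = 0)
  compat : ∀ x i j, C (ρ i x) i j = C x i j

/-- the simple root `α_i ∈ ℤ^θ` -/
def al (θ : ℕ) (i : Fin θ) : Fin θ → ℤ := Pi.single i 1

/-- the reflection `s_i^x` of `ℤ^θ`, `s_i^x (α_j) = α_j - c^x_{ij} α_i` -/
def srefl (G : SCG θ X) (x : X) (i : Fin θ) (v : Fin θ → ℤ) : Fin θ → ℤ :=
  fun k => v k - (if k = i then ∑ j, G.C x i j * v j else 0)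

/-- the cone `ℕ₀ α_i + ℕ₀ α_j` -/
def pairCone (θ : ℕ) (i j : Fin θ) : Set (Fin θ → ℤ) :=
  {v | ∃ a b : ℕ, v = (a : ℤ) • al θ i + (b : ℤ) • al θ j}

/-- A *generalized root system* on a semi-Cartan graph. -/
structure GRS (G : SCG θ X) : Type where
  /-- the root sets `Δ^x` -/
  Δ : X → Set (Fin θ → ℤ)
  pos_neg : ∀ x, Δ x = (Δ x ∩ {v | ∀ k, 0 ≤ v k}) ∪ (-(Δ x ∩ {v | ∀ k, 0 ≤ v k}))
  simple : ∀ x i, Δ x ∩ {v | ∃ c : ℤ, v = c • al θ i} = {al θ i, -al θ i}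
  reflect : ∀ x i, (srefl G x i) '' Δ x = Δ (G.ρ i x)
  pairFinite : ∀ x i j, (Δ x ∩ pairCone θ i j).Finite
  loop : ∀ x i j, (fun y => G.ρ i (G.ρ j y))^[(Δ x ∩ pairCone θ i j).ncard] x = x

variable (G : SCG θ X)

/-- The entries `m^x_{ij} = |Δ^x ∩ (ℕ₀α_i + ℕ₀α_j)|`. -/
def mnum (R : GRS G) (x : X) (i j : Fin θ) : ℕ := (R.Δ x ∩ pairCone θ i j).ncard

/-- the set of positive roots `Δ^x_+` -/
def posRoots (R : GRS G) (x : X) : Set (Fin θ → ℤ) := R.Δ x ∩ {v | ∀ k, 0 ≤ v k}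

/-- The objects of the Weyl groupoid (a type synonym for `X` carrying a quiver
structure depending on `G`). -/
def Obj (G : SCG θ X) : Type := X

instance : Quiver (Obj G) := ⟨fun a b => {i : Fin θ // G.ρ i (show X from b) = (show X from a)}⟩

/-- objects of the path category -/
def pob (x : X) : Paths (Obj G) := (x : X)

/-- the generating arrow `σ_i^x : ρ_i(x) → x` -/
def genArrow (x : X) (i : Fin θ) : pob G (G.ρ i x) ⟶ pob G x :=
  Quiver.Path.nil.cons (⟨i, rfl⟩ : (show Obj G from G.ρ i x) ⟶ (show Obj G from x))

/-- the source of the word `σ_{i_1}^x σ_{i_2} ⋯ σ_{i_m}` (with target `x`) -/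
def wsrc (G : SCG θ X) : List (Fin θ) → X → X
  | [], x => x
  | i :: l, x => wsrc G l (G.ρ i x)

/-- the path `σ_{i_1}^x σ_{i_2} ⋯ σ_{i_m} : wsrc(w,x) → x` in the free category -/
def pathOf (G : SCG θ X) : (w : List (Fin θ)) → (x : X) → (pob G (wsrc G w x) ⟶ pob G x)
  | [], _ => 𝟙 _
  | i :: l, x => (pathOf G l (G.ρ i x)) ≫ genArrow G x i


/-- transport a path along an equality of sources -/
def castSrc {a b c : X} (h : a = b) (f : pob G a ⟶ pob G c) : pob G b ⟶ pob G c := by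
  subst h; exact f

/-- the alternating word `[i, j, i, j, …]` of length `n` -/
def altWord (i j : Fin θ) : ℕ → List (Fin θ)
  | 0 => []
  | n + 1 => i :: altWord j i n

/-- The defining relations `(σ_i^x σ_j)^{m^x_{ij}} = id_x` of the Weyl groupoid. -/
inductive wrel (R : GRS G) : HomRel (Paths (Obj G))
  | rel (x : X) (i j : Fin θ)
      (h : wsrc G (altWord i j (2 * mnum G R x i j)) x = x) :
      wrel R (castSrc G h (pathOf G (altWord i j (2 * mnum G R x i j)) x))
        (𝟙 (pob G x))

variable (R : GRS G)

/-- The Weyl groupoid, as the quotient of the free category on the quiver of the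
`σ_i^x` by the relations `(σ_i^x σ_j)^{m^x_{ij}} = id_x` (every generator is invertible
in this quotient, so it is indeed a groupoid). -/
def W := CategoryTheory.Quotient (wrel G R)

instance : Category (W G R) := inferInstanceAs (Category (CategoryTheory.Quotient (wrel G R)))

/-- objects of the Weyl groupoid -/
def objW (x : X) : W G R := ⟨pob G x⟩

/-- hom-sets `𝒲(y, x)` of the Weyl groupoid -/
def homW (y x : X) := objW G R y ⟶ objW G R x

instance {y x : X} : CoeSort (homW G R y x) (objW G R y ⟶ objW G R x) := ⟨id⟩

/-- the morphism of the Weyl groupoid defined by the word `σ_{i_1}^x ⋯ σ_{i_m}` -/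
def morW (w : List (Fin θ)) (x : X) : homW G R (wsrc G w x) x :=
  (Quotient.functor (wrel G R)).map (pathOf G w x)

/-- the generator `σ_i^x : ρ_i(x) → x` in the Weyl groupoid -/
def genW (x : X) (i : Fin θ) : homW G R (G.ρ i x) x :=
  (Quotient.functor (wrel G R)).map (genArrow G x i)

/-- transport a morphism of the Weyl groupoid along an equality of sources -/
def castW {a b c : X} (h : a = b) (f : homW G R a c) : homW G R b c := by
  subst h; exact f

/-- transport a morphism of the Weyl groupoid along an equality of targets -/
def castTgt {a c c' : X} (h : c = c') (f : homW G R a c) : homW G R a c' := by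
  subst h; exact f

/-- the length `ℓ(f)` of a morphism of the Weyl groupoid -/
def len {y x : X} (f : homW G R y x) : ℕ :=
  sInf {n | ∃ w : List (Fin θ), w.length = n ∧
    ∃ h : wsrc G w x = y, castW G R h (morW G R w x) = f}

/-- `w` is a reduced expression of the morphism `f ∈ 𝒲(y,x)` -/
def IsRedEx (w : List (Fin θ)) {y x : X} (f : homW G R y x) : Prop :=
  ∃ h : wsrc G w x = y, castW G R h (morW G R w x) = f ∧ w.length = len G R f


section NilHecke

variable (𝕂 : Type) [CommRing 𝕂]

/-- the generator `e^x` of the free algebra -/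
def eF (x : X) : FreeAlgebra 𝕂 (X ⊕ X × Fin θ) := FreeAlgebra.ι 𝕂 (Sum.inl x)

/-- the generator `n_i^x` of the free algebra -/
def nF (x : X) (i : Fin θ) : FreeAlgebra 𝕂 (X ⊕ X × Fin θ) := FreeAlgebra.ι 𝕂 (Sum.inr (x, i))

/-- the word `n_{i_1}^x n_{i_2} ⋯ n_{i_m}` in the free algebra
(superscripts determined by composability) -/
def nWF (G : SCG θ X) (𝕂 : Type) [CommRing 𝕂] :
    List (Fin θ) → X → FreeAlgebra 𝕂 (X ⊕ X × Fin θ)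
  | [], _ => 1
  | i :: l, x => nF 𝕂 x i * nWF G 𝕂 l (G.ρ i x)

/-- The defining relations of the nil-Hecke algebra of `(X, ρ, 𝒞)`. -/
inductive nrel (R : GRS G) (𝕂 : Type) [CommRing 𝕂] :
    FreeAlgebra 𝕂 (X ⊕ X × Fin θ) → FreeAlgebra 𝕂 (X ⊕ X × Fin θ) → Prop
  | orth (x y : X) (h : x ≠ y) : nrel R 𝕂 (eF 𝕂 x * eF 𝕂 y) 0
  | idem (x : X) : nrel R 𝕂 (eF 𝕂 x * eF 𝕂 x) (eF 𝕂 x)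
  | total : nrel R 𝕂 (∑ x : X, eF 𝕂 x) 1
  | unit_right (x : X) (i : Fin θ) : nrel R 𝕂 (nF 𝕂 x i * eF 𝕂 (G.ρ i x)) (nF 𝕂 x i)
  | unit_left (x : X) (i : Fin θ) : nrel R 𝕂 (eF 𝕂 x * nF 𝕂 x i) (nF 𝕂 x i)
  | nil (x : X) (i : Fin θ) : nrel R 𝕂 (nF 𝕂 (G.ρ i x) i * nF 𝕂 x i) 0
  | braid (x : X) (i j : Fin θ) (hij : i ≠ j) :
      nrel R 𝕂 (nWF G 𝕂 (altWord i j (mnum G R x i j)) x)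
        (nWF G 𝕂 (altWord j i (mnum G R x i j)) x)

/-- The nil-Hecke algebra `𝒩(X, ρ, 𝒞)` of a Weyl groupoid over `𝕂`. -/
def NH := RingQuot (nrel G R 𝕂)

instance : Ring (NH G R 𝕂) := inferInstanceAs (Ring (RingQuot (nrel G R 𝕂)))
instance : Algebra 𝕂 (NH G R 𝕂) := inferInstanceAs (Algebra 𝕂 (RingQuot (nrel G R 𝕂)))

/-- the generator `e^x` of the nil-Hecke algebra -/
def eN (x : X) : NH G R 𝕂 := RingQuot.mkAlgHom 𝕂 (nrel G R 𝕂) (eF 𝕂 x)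

/-- the generator `n_i^x` of the nil-Hecke algebra -/
def nN (x : X) (i : Fin θ) : NH G R 𝕂 := RingQuot.mkAlgHom 𝕂 (nrel G R 𝕂) (nF 𝕂 x i)

/-- the word `n_{i_1}^x n_{i_2} ⋯ n_{i_m}` in the nil-Hecke algebra -/
def nW (w : List (Fin θ)) (x : X) : NH G R 𝕂 := RingQuot.mkAlgHom 𝕂 (nrel G R 𝕂) (nWF G 𝕂 w x)

/-- the set of morphisms of the Weyl groupoid -/
def Mor := Σ (y : X) (x : X), homW G R y x

/-- the free `𝕂`-module `𝕂𝒲` on the set of morphisms of the Weyl groupoid -/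
abbrev KW := Mor G R →₀ 𝕂

/-- the endomorphism `E^x` of `𝕂𝒲` -/
def Emap (x : X) : KW G R 𝕂 →ₗ[𝕂] KW G R 𝕂 :=
  Finsupp.lift (KW G R 𝕂) 𝕂 (Mor G R)
    (fun m => if m.2.1 = x then Finsupp.single m 1 else 0)

/-- the value of the endomorphism `L_i^x` of `𝕂𝒲` on a basis morphism -/
def Lval (x : X) (i : Fin θ) (m : Mor G R) : KW G R 𝕂 :=
  if h : m.2.1 = G.ρ i x then
    (let f' : homW G R m.1 x := castTgt G R h m.2.2 ≫ genW G R x i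
     if len G R m.2.2 < len G R f' then Finsupp.single ⟨m.1, x, f'⟩ 1 else 0)
  else 0

/-- the endomorphism `L_i^x` of `𝕂𝒲` -/
def Lmap (x : X) (i : Fin θ) : KW G R 𝕂 →ₗ[𝕂] KW G R 𝕂 :=
  Finsupp.lift (KW G R 𝕂) 𝕂 (Mor G R) (Lval G R 𝕂 x i)

end NilHecke

end WeylGroupoid


namespace WeylGroupoid

variable {θ : ℕ} {X : Type} [Fintype X] [DecidableEq X]

/-- The ring automorphism of `𝕂 = ℤ[t_1,…,t_θ]` induced by the reflection `s_i^x`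
(via the identification `α_i ↦ t_i`): `t_j ↦ t_j - c^x_{ij} t_i`. -/
def sAct (G : SCG θ X) (x : X) (i : Fin θ) :
    MvPolynomial (Fin θ) ℤ →+* MvPolynomial (Fin θ) ℤ :=
  (MvPolynomial.aeval fun j => MvPolynomial.X j - MvPolynomial.C (G.C x i j) * MvPolynomial.X i :
    MvPolynomial (Fin θ) ℤ →ₐ[ℤ] MvPolynomial (Fin θ) ℤ).toRingHom

/-- the linear polynomial attached to `v ∈ ℤ^θ` under `α_i ↦ t_i` -/
def lin {θ : ℕ} (v : Fin θ → ℤ) : MvPolynomial (Fin θ) ℤ := ∑ k, MvPolynomial.C (v k) * MvPolynomial.X k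

/-- `h_i^x(t) = e^x + t n_i^x` if `ρ_i(x) = x`, and `h_i^x(t) = t n_i^x` otherwise. -/
def hGen (G : SCG θ X) (R : GRS G) (x : X) (i : Fin θ) (t : MvPolynomial (Fin θ) ℤ) :
    NH G R (MvPolynomial (Fin θ) ℤ) :=
  if G.ρ i x = x then eN G R _ x + t • nN G R _ x i else t • nN G R _ x i

/-- The product `h_{i_1}^{x_1}(s·t_{i_1}) h_{i_2}^{x_2}((s∘s_{i_1}^{x_1})·t_{i_2}) ⋯`;
with `s = id` this is
`h_{i_1}^{x_1}(t_{i_1}) h_{i_2}^{x_2}(s_{i_1}^{x_1}·t_{i_2}) ⋯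
 h_{i_m}^{x_m}(s_{i_1}^{x_1}⋯s_{i_{m-1}}·t_{i_m})`,
where `x_{k+1} = ρ_{i_k}(x_k)`. -/
def hP (G : SCG θ X) (R : GRS G) :
    List (Fin θ) → X → (MvPolynomial (Fin θ) ℤ →+* MvPolynomial (Fin θ) ℤ) →
      NH G R (MvPolynomial (Fin θ) ℤ)
  | [], _, _ => 1
  | i :: l, x, s => hGen G R x i (s (MvPolynomial.X i)) * hP G R l (G.ρ i x) (s.comp (sAct G x i))

/-- the composite ring automorphism `s_{i_1}^{x_1} s_{i_2}^{x_2} ⋯ s_{i_m}^{x_m}` of `𝕂`,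
where `x_{k+1} = ρ_{i_k}(x_k)` -/
def sComp (G : SCG θ X) :
    List (Fin θ) → X → (MvPolynomial (Fin θ) ℤ →+* MvPolynomial (Fin θ) ℤ)
  | [], _ => RingHom.id _
  | i :: l, x => (sAct G x i).comp (sComp G l (G.ρ i x))

end WeylGroupoid

namespace WeylGroupoid

section Alternating

variable {K A : Type*} [CommRing K] [Ring A] [Algebra K A]

/-- A linear combination of the alternating words of length at most six in `u` and `v`; the
coefficients `p k` belong to the words starting with `u`, the `q k` to those starting with `v`. -/
def altComb (e u v : A) (c p₁ p₂ p₃ p₄ p₅ p₆ q₁ q₂ q₃ q₄ q₅ q₆ : K) : A :=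
  c • e + p₁ • u + p₂ • (u * v) + p₃ • (u * v * u) + p₄ • (u * v * u * v)
    + p₅ • (u * v * u * v * u) + p₆ • (u * v * u * v * u * v)
    + q₁ • v + q₂ • (v * u) + q₃ • (v * u * v) + q₄ • (v * u * v * u)
    + q₅ • (v * u * v * u * v) + q₆ • (v * u * v * u * v * u)

variable {e u v : A}

theorem add_smul_mul_altComb_left (hee : e * e = e) (heu : e * u = u) (hue : u * e = u)
    (hev : e * v = v) (huu : u * u = 0)
    (t c p₁ p₂ p₃ p₄ p₅ p₆ q₁ q₂ q₃ q₄ q₅ : K) :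
    (e + t • u) * altComb e u v c p₁ p₂ p₃ p₄ p₅ p₆ q₁ q₂ q₃ q₄ q₅ 0 =
      altComb e u v c (p₁ + t * c) (p₂ + t * q₁) (p₃ + t * q₂) (p₄ + t * q₃) (p₅ + t * q₄)
        (p₆ + t * q₅) q₁ q₂ q₃ q₄ q₅ 0 := by
  simp only [altComb, add_mul, mul_add, mul_smul_comm, smul_mul_assoc, ← mul_assoc, hee, heu, hue,
    hev, huu, zero_mul, smul_zero]
  module

theorem add_smul_mul_altComb_right (hee : e * e = e) (heu : e * u = u)
    (hev : e * v = v) (hve : v * e = v) (hvv : v * v = 0)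
    (t c p₁ p₂ p₃ p₄ p₅ q₁ q₂ q₃ q₄ q₅ q₆ : K) :
    (e + t • v) * altComb e u v c p₁ p₂ p₃ p₄ p₅ 0 q₁ q₂ q₃ q₄ q₅ q₆ =
      altComb e u v c p₁ p₂ p₃ p₄ p₅ 0 (q₁ + t * c) (q₂ + t * p₁) (q₃ + t * p₂) (q₄ + t * p₃)
        (q₅ + t * p₄) (q₆ + t * p₅) := by
  simp only [altComb, add_mul, mul_add, mul_smul_comm, smul_mul_assoc, ← mul_assoc, hee, heu, hve,
    hev, hvv, zero_mul, smul_zero]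
  module

theorem add_smul_left_mul_add_smul_right (hee : e * e = e) (hue : u * e = u) (hev : e * v = v)
    (s t : K) :
    (e + s • u) * (e + t • v) = altComb e u v 1 s (s * t) 0 0 0 0 t 0 0 0 0 0 := by
  simp only [altComb, add_mul, mul_add, mul_smul_comm, smul_mul_assoc, hee, hue, hev]
  module

theorem add_smul_right_mul_add_smul_left (hee : e * e = e) (heu : e * u = u) (hve : v * e = v)
    (s t : K) :
    (e + s • v) * (e + t • u) = altComb e u v 1 t 0 0 0 0 0 s (s * t) 0 0 0 0 := by
  simp only [altComb, add_mul, mul_add, mul_smul_comm, smul_mul_assoc, hee, heu, hve]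
  module

theorem yangBaxter_A₁A₁ (hee : e * e = e) (heu : e * u = u) (hue : u * e = u)
    (hev : e * v = v) (hve : v * e = v)
    (hb : u * v = v * u) (a b : K) :
    (e + a • u) * (e + b • v) = (e + b • v) * (e + a • u) := by
  simp only [add_mul, mul_add, mul_smul_comm, smul_mul_assoc, hee, heu, hue, hev, hve, hb]
  module

theorem yangBaxter_A₂ (hee : e * e = e) (heu : e * u = u) (hue : u * e = u)
    (hev : e * v = v) (hve : v * e = v) (huu : u * u = 0) (hvv : v * v = 0)
    (hb : u * v * u = v * u * v) (a b : K) :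
    (e + a • u) * ((e + (a + b) • v) * (e + b • u)) =
      (e + b • v) * ((e + (a + b) • u) * (e + a • v)) := by
  simp only [add_smul_left_mul_add_smul_right hee hue hev,
    add_smul_right_mul_add_smul_left hee heu hve,
    add_smul_mul_altComb_left hee heu hue hev huu,
    add_smul_mul_altComb_right hee heu hev hve hvv, mul_zero, add_zero]
  simp only [altComb, hb]
  module

theorem yangBaxter_B₂ (hee : e * e = e) (heu : e * u = u) (hue : u * e = u)
    (hev : e * v = v) (hve : v * e = v) (huu : u * u = 0) (hvv : v * v = 0)
    (hb : u * v * u * v = v * u * v * u) (a b : K) :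
    (e + a • u) * ((e + (2 * a + b) • v) * ((e + (a + b) • u) * (e + b • v))) =
      (e + b • v) * ((e + (a + b) • u) * ((e + (2 * a + b) • v) * (e + a • u))) := by
  simp only [add_smul_left_mul_add_smul_right hee hue hev,
    add_smul_right_mul_add_smul_left hee heu hve,
    add_smul_mul_altComb_left hee heu hue hev huu,
    add_smul_mul_altComb_right hee heu hev hve hvv, mul_zero, add_zero]
  simp only [altComb, hb]
  module

theorem yangBaxter_G₂ (hee : e * e = e) (heu : e * u = u) (hue : u * e = u)
    (hev : e * v = v) (hve : v * e = v) (huu : u * u = 0) (hvv : v * v = 0)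
    (hb : u * v * u * v * u * v = v * u * v * u * v * u) (a b : K) :
    (e + a • u) * ((e + (3 * a + b) • v) * ((e + (2 * a + b) • u) * ((e + (3 * a + 2 * b) • v) *
      ((e + (a + b) • u) * (e + b • v))))) =
    (e + b • v) * ((e + (a + b) • u) * ((e + (3 * a + 2 * b) • v) * ((e + (2 * a + b) • u) *
      ((e + (3 * a + b) • v) * (e + a • u))))) := by
  simp only [add_smul_left_mul_add_smul_right hee hue hev,
    add_smul_right_mul_add_smul_left hee heu hve,
    add_smul_mul_altComb_left hee heu hue hev huu,
    add_smul_mul_altComb_right hee heu hev hve hvv, mul_zero, add_zero]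
  simp only [altComb, hb]
  module

end Alternating

section RankTwo

/-- The combinatorial data of the positive roots of a rank two root system with one object:
`(p, q) ∈ S` stands for a positive root `p α + q β`, and `-a`, `-b` are the off-diagonal entries of
the Cartan matrix. -/
structure IsRankTwoRoots (a b : ℤ) (S : Set (ℤ × ℤ)) : Prop where
  finite : S.Finite
  nonneg : ∀ p q, (p, q) ∈ S → 0 ≤ p ∧ 0 ≤ q
  fst_mem : (1, 0) ∈ S
  snd_mem : (0, 1) ∈ S
  eq_one_of_fst : ∀ p, (p, 0) ∈ S → p = 1
  eq_one_of_snd : ∀ q, (0, q) ∈ S → q = 1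
  reflect_fst : ∀ p q, (p, q) ∈ S → 0 < q → (a * q - p, q) ∈ S
  reflect_snd : ∀ p q, (p, q) ∈ S → 0 < p → (p, b * p - q) ∈ S

namespace IsRankTwoRoots

variable {a b : ℤ} {S : Set (ℤ × ℤ)}

theorem mul_lt_four (h : IsRankTwoRoots a b S) (ha : 0 ≤ a) (hb : 0 ≤ b) : a * b < 4 := by
  by_contra! hab
  have hb0 : 0 < b := by
    rcases hb.eq_or_lt with rfl | hb
    · simp at hab
    · exact hb
  have ha0 : 0 < a := by
    rcases ha.eq_or_lt with rfl | ha
    · simp at hab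
    · exact ha
  have hfin : (S ∩ {z | 0 < z.1 ∧ b * z.1 < 2 * z.2}).Finite := h.finite.inter_of_left _
  have hmem : (1, b) ∈ S := by simpa using h.reflect_snd 1 0 h.fst_mem one_pos
  obtain ⟨⟨p, q⟩, ⟨hS, hp, hpq⟩, hmax⟩ := Set.exists_max_image _ Prod.fst hfin
    ⟨(1, b), hmem, one_pos, by simp; omega⟩
  simp only at hp hpq
  have hq : 0 < q := by nlinarith
  have h₁ : 2 * p < a * q := by nlinarith
  have h₂ := h.reflect_fst p q hS hq
  have h₃ := h.reflect_snd _ q h₂ (by linarith)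
  have := hmax _ ⟨h₃, by simp only; linarith, by simp only; nlinarith⟩
  simp only at this
  linarith

theorem eq_of_zero (h : IsRankTwoRoots 0 0 S) : S = {(1, 0), (0, 1)} := by
  ext ⟨p, q⟩
  simp only [Set.mem_insert_iff, Set.mem_singleton_iff, Prod.mk.injEq]
  constructor
  · intro hS
    have h₀ := h.nonneg p q hS
    rcases h₀.2.eq_or_lt with rfl | hq
    · exact .inl ⟨h.eq_one_of_fst p hS, rfl⟩
    · have h₁ := h.reflect_fst p q hS hq
      have h₂ := h.nonneg _ _ h₁
      obtain rfl : p = 0 := by omega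
      exact .inr ⟨rfl, h.eq_one_of_snd q hS⟩
  · rintro (⟨rfl, rfl⟩ | ⟨rfl, rfl⟩)
    exacts [h.fst_mem, h.snd_mem]

theorem eq_of_one (h : IsRankTwoRoots 1 1 S) : S = {(1, 0), (0, 1), (1, 1)} := by
  ext ⟨p, q⟩
  simp only [Set.mem_insert_iff, Set.mem_singleton_iff, Prod.mk.injEq]
  have hf := h.eq_one_of_fst
  have hs := h.eq_one_of_snd
  have hr := h.reflect_fst
  have ht := h.reflect_snd
  have hn := h.nonneg
  constructor
  · grind
  · have := h.fst_mem
    have := h.snd_mem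
    grind

theorem eq_of_two (h : IsRankTwoRoots 2 1 S) : S = {(1, 0), (0, 1), (1, 1), (2, 1)} := by
  ext ⟨p, q⟩
  simp only [Set.mem_insert_iff, Set.mem_singleton_iff, Prod.mk.injEq]
  have hf := h.eq_one_of_fst
  have hs := h.eq_one_of_snd
  have hr := h.reflect_fst
  have ht := h.reflect_snd
  have hn := h.nonneg
  constructor
  · grind
  · have := h.fst_mem
    have := h.snd_mem
    grind

theorem eq_of_three (h : IsRankTwoRoots 3 1 S) :
    S = {(1, 0), (0, 1), (1, 1), (2, 1), (3, 1), (3, 2)} := by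
  ext ⟨p, q⟩
  simp only [Set.mem_insert_iff, Set.mem_singleton_iff, Prod.mk.injEq]
  have hf := h.eq_one_of_fst
  have hs := h.eq_one_of_snd
  have hr := h.reflect_fst
  have ht := h.reflect_snd
  have hn := h.nonneg
  constructor
  · grind
  · have := h.fst_mem
    have := h.snd_mem
    grind

theorem classification (h : IsRankTwoRoots a b S) (hb : 0 ≤ b) (hba : b ≤ a)
    (h0 : a = 0 ↔ b = 0) :
    (a = 0 ∧ b = 0 ∧ S.ncard = 2) ∨ (a = 1 ∧ b = 1 ∧ S.ncard = 3) ∨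
      (a = 2 ∧ b = 1 ∧ S.ncard = 4) ∨ (a = 3 ∧ b = 1 ∧ S.ncard = 6) := by
  have hab := h.mul_lt_four (hb.trans hba) hb
  have hcases : (a = 0 ∧ b = 0) ∨ (a = 1 ∧ b = 1) ∨ (a = 2 ∧ b = 1) ∨ (a = 3 ∧ b = 1) := by
    have : b < 2 := by nlinarith
    obtain rfl | rfl : b = 0 ∨ b = 1 := by omega
    all_goals omega
  rcases hcases with ⟨rfl, rfl⟩ | ⟨rfl, rfl⟩ | ⟨rfl, rfl⟩ | ⟨rfl, rfl⟩
  · simp [h.eq_of_zero, Set.ncard_eq_toFinset_card']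
  · simp [h.eq_of_one, Set.ncard_eq_toFinset_card']
  · simp [h.eq_of_two, Set.ncard_eq_toFinset_card']
  · simp [h.eq_of_three, Set.ncard_eq_toFinset_card']

end IsRankTwoRoots

end RankTwo

variable {θ : ℕ} {X : Type} [Fintype X] [DecidableEq X]

theorem srefl_smul_al_add (G : SCG θ X) (x : X) (i j : Fin θ) (p q : ℤ) :
    srefl G x i (p • al θ i + q • al θ j) = (-G.C x i j * q - p) • al θ i + q • al θ j := by
  ext k
  simp only [srefl, al, Pi.add_apply, Pi.smul_apply, smul_eq_mul, mul_add, Finset.sum_add_distrib,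
    Pi.single_apply, mul_ite, mul_one, mul_zero, Finset.sum_ite_eq', Finset.mem_univ, if_true,
    G.diag]
  split_ifs <;> ring

theorem mnum_comm (G : SCG θ X) (R : GRS G) (x : X) (i j : Fin θ) :
    mnum G R x i j = mnum G R x j i := by
  have : pairCone θ i j = pairCone θ j i := by
    ext v
    constructor <;> rintro ⟨a, b, rfl⟩ <;> exact ⟨b, a, add_comm _ _⟩
  rw [mnum, mnum, this]

/-- The coordinates of the positive roots at `x` in the plane spanned by `α_i` and `α_j`. -/
def planeRoots (G : SCG θ X) (R : GRS G) (x : X) (i j : Fin θ) : Set (ℤ × ℤ) :=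
  {z | z.1 • al θ i + z.2 • al θ j ∈ R.Δ x ∧ 0 ≤ z.1 ∧ 0 ≤ z.2}

section Plane

variable {i j : Fin θ}

theorem smul_al_add_apply_left (hij : i ≠ j) (p q : ℤ) :
    (p • al θ i + q • al θ j) i = p := by
  simp [al, hij.symm]

theorem smul_al_add_apply_right (hij : i ≠ j) (p q : ℤ) :
    (p • al θ i + q • al θ j) j = q := by
  simp [al, hij]

theorem smul_al_add_injective (hij : i ≠ j) :
    Function.Injective fun z : ℤ × ℤ => z.1 • al θ i + z.2 • al θ j := by
  rintro ⟨p, q⟩ ⟨p', q'⟩ h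
  refine Prod.ext ?_ ?_
  · simpa only [smul_al_add_apply_left hij] using congrFun h i
  · simpa only [smul_al_add_apply_right hij] using congrFun h j

theorem image_planeRoots (G : SCG θ X) (R : GRS G) (x : X) :
    (fun z : ℤ × ℤ => z.1 • al θ i + z.2 • al θ j) '' planeRoots G R x i j =
      R.Δ x ∩ pairCone θ i j := by
  ext v
  constructor
  · rintro ⟨⟨p, q⟩, ⟨h, hp, hq⟩, rfl⟩
    lift p to ℕ using hp
    lift q to ℕ using hq
    exact ⟨h, p, q, rfl⟩
  · rintro ⟨h, p, q, rfl⟩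
    exact ⟨(p, q), ⟨h, by simp, by simp⟩, rfl⟩

theorem ncard_planeRoots (G : SCG θ X) (R : GRS G) (x : X) (hij : i ≠ j) :
    (planeRoots G R x i j).ncard = mnum G R x i j := by
  rw [mnum, ← image_planeRoots, Set.ncard_image_of_injective _ (smul_al_add_injective hij)]

theorem nonneg_or_nonpos_of_mem (G : SCG θ X) (R : GRS G) {x : X} {v : Fin θ → ℤ}
    (hv : v ∈ R.Δ x) : (∀ k, 0 ≤ v k) ∨ ∀ k, v k ≤ 0 := by
  rw [R.pos_neg x] at hv
  rcases hv with hv | hv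
  · exact .inl hv.2
  · exact .inr fun k => by simpa using hv.2 k

theorem al_mem (G : SCG θ X) (R : GRS G) (x : X) (i : Fin θ) : al θ i ∈ R.Δ x := by
  have : al θ i ∈ R.Δ x ∩ {v | ∃ c : ℤ, v = c • al θ i} := by
    rw [R.simple x i]
    exact Set.mem_insert _ _
  exact this.1

theorem eq_one_of_smul_al_mem (G : SCG θ X) (R : GRS G) {x : X} {i : Fin θ} {p : ℤ}
    (h : p • al θ i ∈ R.Δ x) (hp : 0 ≤ p) : p = 1 := by
  have h' : p • al θ i ∈ R.Δ x ∩ {v | ∃ c : ℤ, v = c • al θ i} := ⟨h, p, rfl⟩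
  rw [R.simple x i] at h'
  rcases h' with h' | h'
  · simpa [al] using congrFun h' i
  · have : p = -1 := by simpa [al] using congrFun h' i
    omega

theorem reflect_mem (G : SCG θ X) (R : GRS G) {x : X} (hx : G.ρ i x = x) {p q : ℤ}
    (h : p • al θ i + q • al θ j ∈ R.Δ x) :
    (-G.C x i j * q - p) • al θ i + q • al θ j ∈ R.Δ x := by
  have := Set.mem_image_of_mem (srefl G x i) h
  rwa [R.reflect, hx, srefl_smul_al_add] at this

theorem isRankTwoRoots_planeRoots (G : SCG θ X) (R : GRS G) {x : X} (hij : i ≠ j)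
    (hi : G.ρ i x = x) (hj : G.ρ j x = x) :
    IsRankTwoRoots (-G.C x i j) (-G.C x j i) (planeRoots G R x i j) where
  finite := by
    refine Set.Finite.of_finite_image ?_ (smul_al_add_injective hij).injOn
    rw [image_planeRoots]
    exact R.pairFinite x i j
  nonneg p q h := h.2
  fst_mem := ⟨by simpa using al_mem G R x i, by simp, by simp⟩
  snd_mem := ⟨by simpa using al_mem G R x j, by simp, by simp⟩
  eq_one_of_fst p h := eq_one_of_smul_al_mem G R (by simpa using h.1) h.2.1
  eq_one_of_snd q h := eq_one_of_smul_al_mem G R (by simpa using h.1) h.2.2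
  reflect_fst p q h hq := by
    have h' := reflect_mem G R hi h.1
    refine ⟨h', ?_, h.2.2⟩
    rcases nonneg_or_nonpos_of_mem G R h' with hn | hn
    · simpa only [smul_al_add_apply_left hij] using hn i
    · have := hn j
      rw [smul_al_add_apply_right hij] at this
      exact absurd hq this.not_gt
  reflect_snd p q h hp := by
    have h' := h.1
    rw [add_comm] at h'
    replace h' := reflect_mem G R hj h'
    rw [add_comm] at h'
    refine ⟨h', h.2.1, ?_⟩
    rcases nonneg_or_nonpos_of_mem G R h' with hn | hn
    · simpa only [smul_al_add_apply_right hij] using hn j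
    · have := hn i
      rw [smul_al_add_apply_left hij] at this
      exact absurd hp this.not_gt

end Plane

section Relations

variable (G : SCG θ X) (R : GRS G) (𝕂 : Type) [CommRing 𝕂]

theorem eN_mul_self (x : X) : eN G R 𝕂 x * eN G R 𝕂 x = eN G R 𝕂 x :=
  (map_mul _ _ _).symm.trans (RingQuot.mkAlgHom_rel 𝕂 (nrel.idem x))

theorem eN_mul_nN (x : X) (i : Fin θ) : eN G R 𝕂 x * nN G R 𝕂 x i = nN G R 𝕂 x i :=
  (map_mul _ _ _).symm.trans (RingQuot.mkAlgHom_rel 𝕂 (nrel.unit_left x i))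

theorem nN_mul_eN (x : X) (i : Fin θ) :
    nN G R 𝕂 x i * eN G R 𝕂 (G.ρ i x) = nN G R 𝕂 x i :=
  (map_mul _ _ _).symm.trans (RingQuot.mkAlgHom_rel 𝕂 (nrel.unit_right x i))

theorem nN_mul_nN (x : X) (i : Fin θ) : nN G R 𝕂 (G.ρ i x) i * nN G R 𝕂 x i = 0 :=
  ((map_mul _ _ _).symm.trans (RingQuot.mkAlgHom_rel 𝕂 (nrel.nil x i))).trans (map_zero _)

theorem nW_cons (i : Fin θ) (l : List (Fin θ)) (x : X) :
    nW G R 𝕂 (i :: l) x = nN G R 𝕂 x i * nW G R 𝕂 l (G.ρ i x) :=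
  map_mul _ _ _

theorem nW_nil (x : X) : nW G R 𝕂 [] x = 1 :=
  map_one _

theorem nW_braid (x : X) {i j : Fin θ} (hij : i ≠ j) :
    nW G R 𝕂 (altWord i j (mnum G R x i j)) x = nW G R 𝕂 (altWord j i (mnum G R x i j)) x :=
  RingQuot.mkAlgHom_rel 𝕂 (nrel.braid x i j hij)

end Relations

theorem sAct_X (G : SCG θ X) (x : X) (i j : Fin θ) :
    sAct G x i (MvPolynomial.X j) =
      MvPolynomial.X j - MvPolynomial.C (G.C x i j) * MvPolynomial.X i := by
  simp [sAct]

theorem sAct_C (G : SCG θ X) (x : X) (i : Fin θ) (n : ℤ) :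
    sAct G x i (MvPolynomial.C n) = MvPolynomial.C n := by
  simp [sAct]

/-- The braid identity when the Cartan entries satisfy `-c_{ji} ≤ -c_{ij}`. -/
theorem hP_braid_of_le (G : SCG θ X) (R : GRS G) {x : X} {i j : Fin θ} (hij : i ≠ j)
    (hi : G.ρ i x = x) (hj : G.ρ j x = x) (hle : G.C x i j ≤ G.C x j i) :
    hP G R (altWord i j (mnum G R x i j)) x (RingHom.id _) =
      hP G R (altWord j i (mnum G R x i j)) x (RingHom.id _) := by
  have hee := eN_mul_self G R (MvPolynomial (Fin θ) ℤ) x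
  have heu := eN_mul_nN G R (MvPolynomial (Fin θ) ℤ) x i
  have hev := eN_mul_nN G R (MvPolynomial (Fin θ) ℤ) x j
  have hue := nN_mul_eN G R (MvPolynomial (Fin θ) ℤ) x i
  have hve := nN_mul_eN G R (MvPolynomial (Fin θ) ℤ) x j
  have huu := nN_mul_nN G R (MvPolynomial (Fin θ) ℤ) x i
  have hvv := nN_mul_nN G R (MvPolynomial (Fin θ) ℤ) x j
  have hb := nW_braid G R (MvPolynomial (Fin θ) ℤ) x hij
  rw [hi] at hue huu
  rw [hj] at hve hvv
  have hroots := (isRankTwoRoots_planeRoots G R hij hi hj).classification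
    (neg_nonneg.2 (G.offdiag x j i hij.symm)) (neg_le_neg hle)
    (by simpa only [neg_eq_zero] using G.zero_iff x i j hij)
  rw [ncard_planeRoots G R x hij] at hroots
  have hii := G.diag x i
  have hjj := G.diag x j
  rcases hroots with ⟨ha, hc, hm⟩ | ⟨ha, hc, hm⟩ | ⟨ha, hc, hm⟩ | ⟨ha, hc, hm⟩ <;>
    rw [neg_eq_iff_eq_neg] at ha hc <;>
    rw [hm] at hb ⊢ <;>
    simp only [altWord, nW_cons, nW_nil, hi, hj, mul_one, ← mul_assoc] at hb <;>
    simp only [altWord, hP, hGen, hi, hj, if_true, mul_one, RingHom.id_apply, RingHom.comp_apply,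
      sAct_X, map_sub, map_mul, sAct_C, ha, hc, hii, hjj]
  · convert yangBaxter_A₁A₁ hee heu hue hev hve hb (MvPolynomial.X i) (MvPolynomial.X j) <;>
      simp only [map_neg, map_zero] <;> ring
  · convert yangBaxter_A₂ hee heu hue hev hve huu hvv hb (MvPolynomial.X i) (MvPolynomial.X j) <;>
      simp only [map_neg, map_one, map_ofNat] <;> ring
  · convert yangBaxter_B₂ hee heu hue hev hve huu hvv hb (MvPolynomial.X i) (MvPolynomial.X j) <;>
      simp only [map_neg, map_one, map_ofNat] <;> ring
  · convert yangBaxter_G₂ hee heu hue hev hve huu hvv hb (MvPolynomial.X i) (MvPolynomial.X j) <;>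
      simp only [map_neg, map_one, map_ofNat] <;> ring

/-- **Lemma 4.4 (one object).** Let `x ∈ X` with `ρ_1(x) = ρ_2(x) = x` and let
`d = m^x_{12}` (finite).  With `i_{2n} = 2, i_{2n+1} = 1, j_{2n} = 1, j_{2n+1} = 2`, one
has, in the nil-Hecke algebra over `𝕂 = ℤ[t_1,…,t_θ]`,
`h_{i_1}^x(t_{i_1}) h_{i_2}^x(s_{i_1}^x·t_{i_2}) ⋯ h_{i_d}^x(s_{i_1}^x⋯s_{i_{d-1}}·t_{i_d})
 = h_{j_1}^x(t_{j_1}) h_{j_2}^x(s_{j_1}^x·t_{j_2}) ⋯ h_{j_d}^x(s_{j_1}^x⋯s_{j_{d-1}}·t_{j_d})`. -/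
theorem hP_braid_one_object {θ : ℕ} {X : Type} [Fintype X] [DecidableEq X]
    (G : SCG θ X) (R : GRS G) (hθ : 2 ≤ θ)
    (one two : Fin θ) (h1 : (one : ℕ) = 0) (h2 : (two : ℕ) = 1)
    (x : X) (hx1 : G.ρ one x = x) (hx2 : G.ρ two x = x)
    (d : ℕ) (hd : d = mnum G R x one two) :
    hP G R (altWord one two d) x (RingHom.id _) =
      hP G R (altWord two one d) x (RingHom.id _) := by
  have hij : one ≠ two := by
    rintro rfl
    omega
  subst hd
  rcases le_total (G.C x one two) (G.C x two one) with hle | hle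
  · exact hP_braid_of_le G R hij hx1 hx2 hle
  · rw [mnum_comm]
    exact (hP_braid_of_le G R hij.symm hx2 hx1 hle).symm

end WeylGroupoid
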